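/- Let ρ : ℝ⁵ → ℝ be a smooth function of the variables (x₁, x₂, x₄, y₀, y₃) and set τ = e^ρ. Then the Hirota bilinear equation (4 D_{x₁} D_{y₃} − D_{y₀} D_{x₄} − D_{y₀} D_{x₁}² D_{x₂}) τ·τ = 0 holds identically if and only if 4ρ_{x₁y₃} − ρ_{y₀x₄} − ρ_{y₀x₁x₁x₂} − 4ρ_{y₀x₁}ρ_{x₁x₂} − 2ρ_{y₀x₂}ρ_{x₁x₁} = 0 holds identically. (This is the unique, up to scalar, degree-4 equation of the 3-Bogoyavlensky hierarchy not contained in the Boussinesq hierarchy.) -/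

import Mathlib

noncomputable section

/-- Partial derivative in the `k`-th coordinate direction. -/
def pd {n : ℕ} (k : Fin n) (f : (Fin n → ℝ) → ℝ) : (Fin n → ℝ) → ℝ :=
  fun x => deriv (fun t => f (Function.update x k t)) (x k)

/-- Iterated partial derivative for a multi-index `m`. -/
def pdM {n : ℕ} (m : Fin n → ℕ) (f : (Fin n → ℝ) → ℝ) : (Fin n → ℝ) → ℝ :=
  (List.finRange n).foldr (fun k g => (pd k)^[m k] g) f

/-- Hirota bilinear operator `D_{z₁}^{a₁} ⋯ D_{zₙ}^{aₙ} f·g`. -/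
def hirota {n : ℕ} (a : Fin n → ℕ) (f g : (Fin n → ℝ) → ℝ) : (Fin n → ℝ) → ℝ :=
  fun x => ∑ i : ((k : Fin n) → Fin (a k + 1)),
    (∏ k, ((-1 : ℝ)) ^ (a k - (i k : ℕ)) * ((a k).choose (i k : ℕ)))
      * pdM (fun k => (i k : ℕ)) f x * pdM (fun k => a k - (i k : ℕ)) g x

open scoped ContDiff in
lemma pd_eq_fderiv {n : ℕ} {f : (Fin n → ℝ) → ℝ} (hf : ContDiff ℝ ∞ f) (k : Fin n) :
    pd k f = fun x => fderiv ℝ f x (Pi.single k 1) := by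
  funext x
  have hfd : HasFDerivAt f (fderiv ℝ f x) (Function.update x k (x k)) := by
    rw [Function.update_eq_self]
    exact (hf.differentiable (by simp) x).hasFDerivAt
  exact (hfd.comp_hasDerivAt (x k) (hasDerivAt_update x k (x k))).deriv

open scoped ContDiff in
@[fun_prop]
lemma contDiff_pd {n : ℕ} {f : (Fin n → ℝ) → ℝ} (hf : ContDiff ℝ ∞ f) (k : Fin n) :
    ContDiff ℝ ∞ (pd k f) := by
  rw [pd_eq_fderiv hf]
  exact (hf.fderiv_right (m := ∞) (by simp)).clm_apply contDiff_const

open scoped ContDiff in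
lemma pd_comm {n : ℕ} {f : (Fin n → ℝ) → ℝ} (hf : ContDiff ℝ ∞ f) (j k : Fin n) :
    pd j (pd k f) = pd k (pd j f) := by
  have hd : Differentiable ℝ (fderiv ℝ f) :=
    (hf.fderiv_right (m := ∞) (by simp)).differentiable (by simp)
  have key (j k : Fin n) (x : Fin n → ℝ) :
      pd j (pd k f) x = fderiv ℝ (fderiv ℝ f) x (Pi.single j 1) (Pi.single k 1) := by
    rw [pd_eq_fderiv (contDiff_pd hf k), pd_eq_fderiv hf k]
    simp [fderiv_clm_apply (hd x) (differentiableAt_const _)]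
  funext x
  rw [key, key]
  have h2 : ((2 : ℕ∞) : WithTop ℕ∞) ≤ ∞ := WithTop.coe_le_coe.2 le_top
  exact (hf.contDiffAt.isSymmSndFDerivAt (by simpa using h2)) _ _

open scoped ContDiff in
lemma pd_add {n : ℕ} {f g : (Fin n → ℝ) → ℝ} (hf : ContDiff ℝ ∞ f) (hg : ContDiff ℝ ∞ g)
    (k : Fin n) : pd k (fun x => f x + g x) = fun x => pd k f x + pd k g x := by
  rw [pd_eq_fderiv (hf.add hg), pd_eq_fderiv hf, pd_eq_fderiv hg]
  funext x
  rw [fderiv_fun_add (hf.differentiable (by simp) x) (hg.differentiable (by simp) x)]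
  rfl

open scoped ContDiff in
lemma pd_mul {n : ℕ} {f g : (Fin n → ℝ) → ℝ} (hf : ContDiff ℝ ∞ f) (hg : ContDiff ℝ ∞ g)
    (k : Fin n) : pd k (fun x => f x * g x) = fun x => pd k f x * g x + f x * pd k g x := by
  rw [pd_eq_fderiv (hf.mul hg), pd_eq_fderiv hf, pd_eq_fderiv hg]
  funext x
  rw [fderiv_fun_mul (hf.differentiable (by simp) x) (hg.differentiable (by simp) x)]
  simp
  ring

open scoped ContDiff in
lemma pd_exp {n : ℕ} {f : (Fin n → ℝ) → ℝ} (hf : ContDiff ℝ ∞ f) (k : Fin n) :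
    pd k (fun x => Real.exp (f x)) = fun x => pd k f x * Real.exp (f x) := by
  rw [pd_eq_fderiv hf.exp, pd_eq_fderiv hf]
  funext x
  rw [fderiv_exp (hf.differentiable (by simp) x)]
  simp [mul_comm]

/-- A sum over the multi-indices bounded by `m`, split along the first coordinate. -/
lemma sum_multiIndex_succ {n : ℕ} (m : Fin (n + 1) → ℕ) (F : (Fin (n + 1) → ℕ) → ℝ) :
    ∑ i : ((k : Fin (n + 1)) → Fin (m k + 1)), F (fun k => (i k : ℕ))
      = ∑ j ∈ Finset.range (m 0 + 1), ∑ i : ((k : Fin n) → Fin (m k.succ + 1)),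
          F (Fin.cons j fun k => (i k : ℕ)) := by
  rw [Finset.sum_range, ← (Fin.consEquiv fun k => Fin (m k + 1)).sum_comp,
    Fintype.sum_prod_type]
  refine Finset.sum_congr rfl fun j _ => Finset.sum_congr rfl fun i _ => congrArg F ?_
  funext k
  refine Fin.cases ?_ (fun k => ?_) k <;> simp [Fin.consEquiv]

/-- A sum over five-component multi-indices as an iterated sum. -/
lemma sum_multiIndex_five (m : Fin 5 → ℕ) (F : (Fin 5 → ℕ) → ℝ) :
    ∑ i : ((k : Fin 5) → Fin (m k + 1)), F (fun k => (i k : ℕ))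
      = ∑ i₀ ∈ Finset.range (m 0 + 1), ∑ i₁ ∈ Finset.range (m 1 + 1),
        ∑ i₂ ∈ Finset.range (m 2 + 1), ∑ i₃ ∈ Finset.range (m 3 + 1),
        ∑ i₄ ∈ Finset.range (m 4 + 1), F ![i₀, i₁, i₂, i₃, i₄] := by
  rw [sum_multiIndex_succ]
  refine Finset.sum_congr rfl fun i₀ _ => ?_
  rw [sum_multiIndex_succ (fun k => m k.succ) fun i => F (Fin.cons i₀ i)]
  refine Finset.sum_congr rfl fun i₁ _ => ?_
  rw [sum_multiIndex_succ (fun k => m k.succ.succ) fun i => F (Fin.cons i₀ (Fin.cons i₁ i))]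
  refine Finset.sum_congr rfl fun i₂ _ => ?_
  rw [sum_multiIndex_succ (fun k => m k.succ.succ.succ)
    fun i => F (Fin.cons i₀ (Fin.cons i₁ (Fin.cons i₂ i)))]
  refine Finset.sum_congr rfl fun i₃ _ => ?_
  rw [sum_multiIndex_succ (fun k => m k.succ.succ.succ.succ)
    fun i => F (Fin.cons i₀ (Fin.cons i₁ (Fin.cons i₂ (Fin.cons i₃ i))))]
  refine Finset.sum_congr rfl fun i₄ _ => ?_
  rw [Fintype.sum_unique]
  refine congrArg F ?_
  funext k
  fin_cases k <;> rfl

/-- The Hirota operator in five variables as an iterated sum. -/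
lemma hirota_five (a : Fin 5 → ℕ) (f g : (Fin 5 → ℝ) → ℝ) (x : Fin 5 → ℝ) :
    hirota a f g x = ∑ i₀ ∈ Finset.range (a 0 + 1), ∑ i₁ ∈ Finset.range (a 1 + 1),
      ∑ i₂ ∈ Finset.range (a 2 + 1), ∑ i₃ ∈ Finset.range (a 3 + 1),
      ∑ i₄ ∈ Finset.range (a 4 + 1),
        (∏ k, (-1 : ℝ) ^ (a k - ![i₀, i₁, i₂, i₃, i₄] k)
            * ((a k).choose (![i₀, i₁, i₂, i₃, i₄] k)))
          * pdM ![i₀, i₁, i₂, i₃, i₄] f x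
          * pdM (fun k => a k - ![i₀, i₁, i₂, i₃, i₄] k) g x :=
  sum_multiIndex_five a fun i =>
    (∏ k, (-1 : ℝ) ^ (a k - i k) * ((a k).choose (i k))) * pdM i f x
      * pdM (fun k => a k - i k) g x

lemma pdM_five (m : Fin 5 → ℕ) (f : (Fin 5 → ℝ) → ℝ) :
    pdM m f = (pd 0)^[m 0] ((pd 1)^[m 1] ((pd 2)^[m 2] ((pd 3)^[m 3] ((pd 4)^[m 4] f)))) := by
  simp [pdM, List.finRange_succ]

/-- for smooth `ρ : ℝ⁵ → ℝ` (coordinates `x₁ = 0`, `x₂ = 1`, `x₄ = 2`,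
`y₀ = 3`, `y₃ = 4`) and `τ = e^ρ`, the Hirota equation
`(4 D_{x₁} D_{y₃} − D_{y₀} D_{x₄} − D_{y₀} D_{x₁}² D_{x₂}) τ·τ = 0` holds identically
iff `4ρ_{x₁y₃} − ρ_{y₀x₄} − ρ_{y₀x₁x₁x₂} − 4ρ_{y₀x₁}ρ_{x₁x₂} − 2ρ_{y₀x₂}ρ_{x₁x₁} = 0`
holds identically. -/
theorem statement6 (ρ : (Fin 5 → ℝ) → ℝ) (hρ : ContDiff ℝ (⊤ : ℕ∞) ρ)
    (τ : (Fin 5 → ℝ) → ℝ) (hτ : τ = fun p => Real.exp (ρ p)) :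
    (∀ p, 4 * hirota ![1, 0, 0, 0, 1] τ τ p - hirota ![0, 0, 1, 1, 0] τ τ p
        - hirota ![2, 1, 0, 1, 0] τ τ p = 0)
    ↔ (∀ p, 4 * pd 0 (pd 4 ρ) p - pd 3 (pd 2 ρ) p
        - pd 3 (pd 0 (pd 0 (pd 1 ρ))) p
        - 4 * pd 3 (pd 0 ρ) p * pd 0 (pd 1 ρ) p
        - 2 * pd 3 (pd 1 ρ) p * pd 0 (pd 0 ρ) p = 0) := by
  have h₀₄ (p) : hirota ![1, 0, 0, 0, 1] τ τ p
      = 2 * Real.exp (ρ p) ^ 2 * pd 0 (pd 4 ρ) p := by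
    rw [hirota_five]
    simp [pdM_five, Finset.sum_range_succ, Fin.prod_univ_succ, hτ, pd_exp, pd_mul,
      contDiff_pd, hρ, ContDiff.exp]
    ring
  have h₂₃ (p) : hirota ![0, 0, 1, 1, 0] τ τ p
      = 2 * Real.exp (ρ p) ^ 2 * pd 2 (pd 3 ρ) p := by
    rw [hirota_five]
    simp [pdM_five, Finset.sum_range_succ, Fin.prod_univ_succ, hτ, pd_exp, pd_mul,
      contDiff_pd, hρ, ContDiff.exp]
    ring
  have h₀₀₁₃ (p) : hirota ![2, 1, 0, 1, 0] τ τ p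
      = 2 * Real.exp (ρ p) ^ 2 * (pd 0 (pd 0 (pd 1 (pd 3 ρ))) p
        + 4 * pd 0 (pd 3 ρ) p * pd 0 (pd 1 ρ) p + 2 * pd 1 (pd 3 ρ) p * pd 0 (pd 0 ρ) p) := by
    rw [hirota_five]
    simp (disch := fun_prop) [pdM_five, Finset.sum_range_succ, Fin.prod_univ_succ, hτ, pd_exp,
      pd_mul, pd_add]
    ring
  refine forall_congr' fun p => ?_
  rw [h₀₄, h₂₃, h₀₀₁₃, pd_comm hρ 3 2, pd_comm (contDiff_pd (contDiff_pd hρ 1) 0) 3 0,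
    pd_comm (contDiff_pd hρ 1) 3 0, pd_comm hρ 3 1, pd_comm hρ 3 0]
  have hne : 2 * Real.exp (ρ p) ^ 2 ≠ 0 := by positivity
  refine Iff.trans ?_ (mul_eq_zero.trans (or_iff_right hne))
  ring_nf
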